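/- arXiv:2301.05834 — 2 statements merged into one kernel-verified Lean document; each statement's English description precedes it below -/
import Mathlib

section
/- Let n ≥ 3 be an integer with n ≡ 2 (mod 3), n ≠ 5 and n ≠ 11. Then there is no lattice tiling of ℤⁿ by the error ball B(n,2,1,1). -/
/-- The error ball `B(n,2,1,1)`: vectors in `ℤⁿ` with entries in `{-1,0,1}`
and at most `2` nonzero coordinates. -/
def errBall (n : ℕ) : Set (Fin n → ℤ) :=
  {a | (∀ i, a i = -1 ∨ a i = 0 ∨ a i = 1) ∧
    (Finset.univ.filter (fun i => a i ≠ 0)).card ≤ 2}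

/-- A lattice tiling of `ℤⁿ` by `V`: a subgroup `L` such that every `x ∈ ℤⁿ`
is uniquely `v + l` with `v ∈ V`, `l ∈ L`. -/
def IsLatticeTiling (n : ℕ) (V : Set (Fin n → ℤ)) (L : AddSubgroup (Fin n → ℤ)) : Prop :=
  ∀ x : Fin n → ℤ, ∃! p : (Fin n → ℤ) × (Fin n → ℤ),
    p.1 ∈ V ∧ p.2 ∈ L ∧ x = p.1 + p.2

def tt {G : Type} [AddCommGroup G] {n : ℕ} (s : Fin n → G) (x : Fin n × Bool) : G :=
  if x.2 then s x.1 else - s x.1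

def ng {n : ℕ} (x : Fin n × Bool) : Fin n × Bool := (x.1, !x.2)

def bmap {G : Type} [AddCommGroup G] {n : ℕ} (s : Fin n → G) :
    Unit ⊕ (Fin n × Bool) ⊕ {p : (Fin n × Bool) × (Fin n × Bool) // p.1.1 < p.2.1} → G
  | .inl _ => 0
  | .inr (.inl x) => tt s x
  | .inr (.inr p) => tt s p.1.1 + tt s p.1.2

theorem tt_ng {G : Type} [AddCommGroup G] {n : ℕ} (s : Fin n → G) (x : Fin n × Bool) :
    tt s (ng x) = - tt s x := by
  rcases x with ⟨i, b⟩
  cases b <;> simp [tt, ng]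

theorem hsum {G : Type} [AddCommGroup G] [Fintype G] {n : ℕ} (s : Fin n → G)
    (hb : Function.Bijective (bmap s)) {A : Type} [CommRing A] (F : G → A) :
    2 * ∑ g, F g = 2 * F 0 + 2 * ∑ x, F (tt s x) + ∑ x, ∑ y, F (tt s x + tt s y)
      - ∑ x, F (2 • tt s x) - 2 * (n : A) * F 0 := by
  classical
  have h1 : ∑ g, F g = F 0 + (∑ x, F (tt s x) +
      ∑ p : {p : (Fin n × Bool) × (Fin n × Bool) // p.1.1 < p.2.1},
        F (tt s p.1.1 + tt s p.1.2)) := by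
    rw [← Equiv.sum_comp (Equiv.ofBijective _ hb)]
    simp [Fintype.sum_sum_type, bmap]
  have h2 : ∑ p : {p : (Fin n × Bool) × (Fin n × Bool) // p.1.1 < p.2.1},
        F (tt s p.1.1 + tt s p.1.2) =
      ∑ p : (Fin n × Bool) × (Fin n × Bool),
        if p.1.1 < p.2.1 then F (tt s p.1 + tt s p.2) else 0 := by
    rw [← Finset.sum_filter]
    exact (Finset.sum_subtype _ (by simp) (fun p : (Fin n × Bool) × (Fin n × Bool) =>
      F (tt s p.1 + tt s p.2))).symm
  have h3 : (∑ p : (Fin n × Bool) × (Fin n × Bool),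
        if p.2.1 < p.1.1 then F (tt s p.1 + tt s p.2) else 0) =
      ∑ p : (Fin n × Bool) × (Fin n × Bool),
        if p.1.1 < p.2.1 then F (tt s p.1 + tt s p.2) else 0 := by
    rw [← Equiv.sum_comp (Equiv.prodComm _ _)]
    simp [add_comm]
  have h4 : (∑ p : (Fin n × Bool) × (Fin n × Bool),
        if p.1.1 = p.2.1 then F (tt s p.1 + tt s p.2) else 0) =
      ∑ x, F (2 • tt s x) + 2 * (n : A) * F 0 := by
    simp only [Fintype.sum_prod_type, Fintype.sum_bool, tt, Finset.sum_add_distrib,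
      Finset.sum_ite_eq, Finset.mem_univ, if_true]
    simp [two_smul]
    ring
  have h5 : ∑ x, ∑ y, F (tt s x + tt s y) =
      (∑ p : (Fin n × Bool) × (Fin n × Bool),
        if p.1.1 < p.2.1 then F (tt s p.1 + tt s p.2) else 0) +
      (∑ p : (Fin n × Bool) × (Fin n × Bool),
        if p.1.1 = p.2.1 then F (tt s p.1 + tt s p.2) else 0) +
      (∑ p : (Fin n × Bool) × (Fin n × Bool),
        if p.2.1 < p.1.1 then F (tt s p.1 + tt s p.2) else 0) := by
    rw [← Finset.sum_add_distrib, ← Finset.sum_add_distrib, ← Fintype.sum_prod_type']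
    refine Finset.sum_congr rfl fun p _ => ?_
    rcases lt_trichotomy p.1.1 p.2.1 with h | h | h
    · simp [h, h.ne, h.not_gt]
    · simp [h]
    · simp [h, h.ne', h.not_gt]
  rw [h5, h4, h3, h1, h2]
  ring

theorem bmap_bij (n : ℕ) (L : AddSubgroup (Fin n → ℤ))
   (errBall : Set (Fin n → ℤ)) (herr : errBall = {a | (∀ i, a i = -1 ∨ a i = 0 ∨ a i = 1) ∧
    (Finset.univ.filter (fun i => a i ≠ 0)).card ≤ 2})
    (h : ∀ x : Fin n → ℤ, ∃! p : (Fin n → ℤ) × (Fin n → ℤ),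
    p.1 ∈ errBall ∧ p.2 ∈ L ∧ x = p.1 + p.2) :
    Function.Bijective (bmap (fun i : Fin n => (QuotientAddGroup.mk' L) (Pi.single i 1))) := by
  classical
  set q := QuotientAddGroup.mk' L
  have hq : ∀ b, bmap (fun i : Fin n => q (Pi.single i 1)) b =
      q (bmap (fun i : Fin n => (Pi.single i 1 : Fin n → ℤ)) b) := by
    have : ∀ x, tt (fun i : Fin n => q (Pi.single i 1)) x =
      q (tt (fun i : Fin n => (Pi.single i 1 : Fin n → ℤ)) x) := by
      rintro ⟨i, b⟩
      cases b <;> simp [tt]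
    rintro (_ | x | p)
    · simp [bmap]
    · simp [bmap, this]
    · simp [bmap, this]
  have htt : ∀ x j, tt (fun i : Fin n => (Pi.single i 1 : Fin n → ℤ)) x j =
      if j = x.1 then (if x.2 then 1 else -1) else 0 := by
    rintro ⟨i, b⟩ j
    cases b <;> simp [tt, Pi.single_apply] <;> split_ifs <;> rfl
  have hmem : ∀ b, bmap (fun i : Fin n => (Pi.single i 1 : Fin n → ℤ)) b ∈ errBall := by
    rw [herr]
    rintro (_ | x | p)
    · simp [bmap]
    · refine ⟨fun i => ?_, ?_⟩
      · simp only [bmap, htt]; split_ifs <;> simp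
      · refine (Finset.card_le_card (t := {x.1}) ?_).trans (by simp)
        intro i; simp only [bmap, htt]; grind
    · refine ⟨fun i => ?_, ?_⟩
      · have := p.2
        simp only [bmap, htt, Pi.add_apply]; grind
      · refine (Finset.card_le_card (t := {p.1.1.1, p.1.2.1}) ?_).trans Finset.card_le_two
        intro i; simp only [bmap, htt, Pi.add_apply]; grind
  have hinj : Function.Injective (bmap (fun i : Fin n => (Pi.single i 1 : Fin n → ℤ))) := by
    rintro (_ | ⟨i, b⟩ | ⟨⟨⟨i, b⟩, ⟨j, c⟩⟩, hp⟩) (_ | ⟨i', b'⟩ | ⟨⟨⟨i', b'⟩, ⟨j', c'⟩⟩, hp'⟩) h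
    · rfl
    all_goals
      have h : ∀ k, _ := fun k => congrFun h k
      simp only [bmap, htt, Pi.add_apply, Pi.zero_apply] at h
    · have := h i'; grind
    · have := h i'; grind
    · have := h i; grind
    · have := h i; have := h i'; grind
    · have := h i; have := h i'; have := h j'; grind
    · have := h i; grind
    · have := h i; have := h j; grind
    · have := h i; have := h i'; have := h j; have := h j'
      simp only [Sum.inr.injEq, Subtype.mk.injEq, Prod.mk.injEq]
      grind
  have hsurj : ∀ v ∈ errBall, ∃ b, bmap (fun i : Fin n => (Pi.single i 1 : Fin n → ℤ)) b = v := by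
    rw [herr]
    rintro v ⟨hv, hc⟩
    have hB : ∀ i, v i ≠ 0 → (if decide (v i = 1) then 1 else -1) = v i := by
      intro i hi
      have := hv i
      grind
    have h3 : ∀ i j, i < j → v i ≠ 0 → v j ≠ 0 → ∀ k, v k ≠ 0 → k = i ∨ k = j := by
      intro i j hij hi hj k hk
      by_contra hne
      push Not at hne
      have : ({i, j, k} : Finset (Fin n)).card ≤ 2 := by
        refine (Finset.card_le_card ?_).trans hc
        intro l; simp; grind
      rw [Finset.card_eq_three.2 ⟨i, j, k, hij.ne, hne.1.symm, hne.2.symm, rfl⟩] at this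
      omega
    by_cases h0 : ∃ i j, i < j ∧ v i ≠ 0 ∧ v j ≠ 0
    · obtain ⟨i, j, hij, hi, hj⟩ := h0
      refine ⟨.inr (.inr ⟨⟨(i, decide (v i = 1)), (j, decide (v j = 1))⟩, hij⟩), ?_⟩
      funext k
      simp only [bmap, htt, Pi.add_apply]
      have := h3 i j hij hi hj k
      have := hB i hi
      have := hB j hj
      grind
    · by_cases h1 : ∃ i, v i ≠ 0
      · obtain ⟨i, hi⟩ := h1
        refine ⟨.inr (.inl (i, decide (v i = 1))), ?_⟩
        funext k
        simp only [bmap, htt]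
        have := hB i hi
        have : v k ≠ 0 → k = i := by
          intro hk
          by_contra hne
          rcases lt_or_gt_of_ne hne with h | h
          · exact h0 ⟨_, _, h, hk, hi⟩
          · exact h0 ⟨_, _, h, hi, hk⟩
        grind
      · push Not at h1
        refine ⟨.inl (), ?_⟩
        funext k
        simp [bmap, h1]
  constructor
  · intro a b hab
    rw [hq, hq] at hab
    apply hinj
    have h' := h (bmap (fun i : Fin n => (Pi.single i 1 : Fin n → ℤ)) a)
    have hd : bmap (fun i : Fin n => (Pi.single i 1 : Fin n → ℤ)) a -
      bmap (fun i : Fin n => (Pi.single i 1 : Fin n → ℤ)) b ∈ L := by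
      rw [← QuotientAddGroup.ker_mk' L, AddMonoidHom.mem_ker, map_sub]
      exact sub_eq_zero.2 hab
    have := h'.unique (y₁ := (bmap (fun i : Fin n => (Pi.single i 1 : Fin n → ℤ)) a, 0))
      (y₂ := (bmap (fun i : Fin n => (Pi.single i 1 : Fin n → ℤ)) b,
        bmap (fun i : Fin n => (Pi.single i 1 : Fin n → ℤ)) a -
          bmap (fun i : Fin n => (Pi.single i 1 : Fin n → ℤ)) b))
      ⟨hmem a, L.zero_mem, (add_zero _).symm⟩
      ⟨hmem b, hd, (add_sub_cancel _ _).symm⟩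
    exact (Prod.mk.inj this).1
  · intro g
    obtain ⟨x, rfl⟩ := QuotientAddGroup.mk'_surjective L g
    obtain ⟨⟨v, l⟩, ⟨hv, hl, hx⟩, -⟩ := h x
    obtain ⟨b, hb⟩ := hsurj v hv
    refine ⟨b, ?_⟩
    rw [hq, hb, hx]
    have : q l = 0 := by
      rw [← AddMonoidHom.mem_ker]; simpa [q] using hl
    simp only [] at *
    rw [map_add, this, add_zero]

section ring
variable {G : Type} [AddCommGroup G]

noncomputable def el (R : Type) [CommRing R] (g : G) : AddMonoidAlgebra R G :=
  AddMonoidAlgebra.single g 1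

theorem el_mul (R : Type) [CommRing R] (g h : G) : el R g * el R h = el R (g + h) := by
  simp [el, AddMonoidAlgebra.single_mul_single]

theorem el_zero (R : Type) [CommRing R] : el R (0 : G) = 1 := rfl

theorem el_pow (R : Type) [CommRing R] (g : G) (k : ℕ) : el R g ^ k = el R (k • g) := by
  simp [el, AddMonoidAlgebra.single_pow]

theorem el_coeff [DecidableEq G] (R : Type) [CommRing R] (g h : G) :
    (el R g).coeff h = if g = h then 1 else 0 := by
  simp [el, AddMonoidAlgebra.coeff_single, Finsupp.single_apply]

variable {n : ℕ}

noncomputable def TT (R : Type) [CommRing R] (s : Fin n → G) (k : ℕ) : AddMonoidAlgebra R G :=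
  ∑ x, el R (k • tt s x)

noncomputable def GG (G : Type) [AddCommGroup G] [Fintype G] (R : Type) [CommRing R] :
    AddMonoidAlgebra R G :=
  ∑ g : G, el R g

def cc [DecidableEq G] (s : Fin n → G) (k : ℕ) (g : G) : ℕ :=
  (Finset.univ.filter (fun x => k • tt s x = g)).card

theorem TT_coeff [DecidableEq G] (R : Type) [CommRing R] (s : Fin n → G) (k : ℕ) (g : G) :
    (TT R s k).coeff g = (cc s k g : R) := by
  simp [TT, AddMonoidAlgebra.coeff_sum, Finsupp.finsetSum_apply, el_coeff, cc]

theorem GG_coeff [Fintype G] (R : Type) [CommRing R] (g : G) :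
    (GG G R).coeff g = 1 := by
  classical
  simp [GG, AddMonoidAlgebra.coeff_sum, Finsupp.finsetSum_apply, el_coeff]

theorem TTmul_coeff [DecidableEq G] (R : Type) [CommRing R] (s : Fin n → G) (k : ℕ) (g : G) :
    (TT R s 1 * TT R s k).coeff g = ((∑ y, cc s 1 (g - k • tt s y) : ℕ) : R) := by
  rw [mul_comm]
  simp only [TT, Finset.sum_mul_sum, el_mul, AddMonoidAlgebra.coeff_sum,
    Finsupp.finsetSum_apply, el_coeff, cc, Nat.cast_sum, Finset.card_filter, Nat.cast_ite,
    Nat.cast_one, Nat.cast_zero]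
  simp only [eq_sub_iff_add_eq, add_comm]

theorem TTGG [Fintype G] (R : Type) [CommRing R] (s : Fin n → G) (k : ℕ) :
    TT R s k * GG G R = (2 * n : R) • GG G R := by
  have : ∀ g : G, el R g * GG G R = GG G R := by
    intro g
    simp only [GG, Finset.mul_sum, el_mul]
    exact Equiv.sum_comp (Equiv.addLeft g) (fun h => el R h)
  simp only [TT, Finset.sum_mul, this]
  simp [Fintype.card_prod, ← Nat.cast_smul_eq_nsmul R, mul_comm]

variable [Fintype G]

theorem T1sq (s : Fin n → G) (hb : Function.Bijective (bmap s)) (R : Type) [CommRing R] :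
    2 * GG G R = 2 + 2 * TT R s 1 + TT R s 1 * TT R s 1 - TT R s 2 - 2 * n := by
  have := hsum s hb (A := AddMonoidAlgebra R G) (el R)
  simp only [el_zero, mul_one] at this
  simp only [TT, Finset.sum_mul_sum, el_mul, GG, one_smul]
  exact this

theorem cardG (s : Fin n → G) (hb : Function.Bijective (bmap s)) :
    Fintype.card G = 2 * n ^ 2 + 1 := by
  have := hsum s hb (A := ℤ) (fun _ => 1)
  simp [Fintype.card_prod] at this
  zify
  linarith

theorem dbl_inj (s : Fin n → G) (hb : Function.Bijective (bmap s)) :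
    Function.Injective (fun g : G => 2 • g) := by
  have h : (Nat.card G).Coprime 2 := by
    rw [Nat.card_eq_fintype_card, cardG s hb]
    simp
  exact (nsmulCoprime h).injective

theorem T2sq (s : Fin n → G) (hb : Function.Bijective (bmap s)) (R : Type) [CommRing R] :
    2 * GG G R = 2 + 2 * TT R s 2 + TT R s 2 * TT R s 2 - TT R s 4 - 2 * n := by
  have := hsum s hb (A := AddMonoidAlgebra R G) (fun g => el R (2 • g))
  have h2 : ∑ g : G, el R (2 • g) = GG G R :=
    Equiv.sum_comp (Equiv.ofBijective _ (Finite.injective_iff_bijective.1 (dbl_inj s hb)))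
      (fun g => el R g)
  rw [h2] at this
  simp only [el_zero, mul_one, smul_zero, smul_add, smul_smul] at this
  simp only [TT, Finset.sum_mul_sum, el_mul]
  exact this

theorem T1T2mod (s : Fin n → G) (hb : Function.Bijective (bmap s)) (hn : n % 3 = 2) :
    TT (ZMod 3) s 1 * TT (ZMod 3) s 2 =
      2 * GG G (ZMod 3) + TT (ZMod 3) s 3 - TT (ZMod 3) s 2 - 2 := by
  have h3' : (3 : ZMod 3) = 0 := rfl
  have h3 : (3 : AddMonoidAlgebra (ZMod 3) G) = 0 := by
    have := map_ofNat (algebraMap (ZMod 3) (AddMonoidAlgebra (ZMod 3) G)) 3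
    rw [← this]
    have : (OfNat.ofNat 3 : ZMod 3) = 0 := by decide
    rw [this, map_zero]
  have : Fact (Nat.Prime 3) := ⟨by norm_num⟩
  have : CharP (AddMonoidAlgebra (ZMod 3) G) 3 :=
    (CharP.charP_iff_prime_eq_zero (by norm_num)).2 (by exact_mod_cast h3)
  have hf : TT (ZMod 3) s 1 ^ 3 = TT (ZMod 3) s 3 := by
    simp only [TT, sum_pow_char, el_pow, one_smul]
  have h1 := T1sq s hb (ZMod 3)
  have hg := TTGG (ZMod 3) s 1
  have hnn : ((2 * n : ZMod 3)) = 1 := by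
    rw [← Nat.mod_add_div n 3, hn]; push_cast
    linear_combination (1 + 2 * ((n / 3 : ℕ) : ZMod 3)) * h3'
  have hnn' : (2 * n : AddMonoidAlgebra (ZMod 3) G) = 1 := by
    rw [← Nat.mod_add_div n 3, hn]; push_cast
    linear_combination (1 + 2 * ((n / 3 : ℕ) : AddMonoidAlgebra (ZMod 3) G)) * h3
  rw [hnn, one_smul] at hg
  rw [hnn'] at h1
  generalize TT (ZMod 3) s 1 = T at *
  generalize TT (ZMod 3) s 2 = T2 at *
  generalize TT (ZMod 3) s 3 = T3 at *
  generalize GG G (ZMod 3) = Gm at *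
  have h1' : T * T = 2 * Gm + T + T2 + 2 := by linear_combination -h1 - (T + 1) * h3
  linear_combination hf - (T + 1) * h1' - 2 * hg + (- T - 2 * Gm) * h3

theorem int_coeff [DecidableEq G] (R : Type) [CommRing R] (k : ℤ) (g : G) :
    ((k : ℤ) : AddMonoidAlgebra R G).coeff g = if g = 0 then (k : R) else 0 := by
  have : ((k : ℤ) : AddMonoidAlgebra R G) = k • el R (0 : G) := by simp [el_zero]
  rw [this, AddMonoidAlgebra.coeff_smul]
  simp [el_coeff, eq_comm]

theorem intmul_coeff (R : Type) [CommRing R] (k : ℤ) (x : AddMonoidAlgebra R G) (g : G) :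
    ((k : AddMonoidAlgebra R G) * x).coeff g = k * x.coeff g := by
  rw [← zsmul_eq_mul, AddMonoidAlgebra.coeff_smul]
  simp

theorem tt_inj (s : Fin n → G) (hb : Function.Bijective (bmap s)) :
    Function.Injective (tt s) := by
  intro x y h
  have := hb.1 (a₁ := .inr (.inl x)) (a₂ := .inr (.inl y)) h
  simpa using this

theorem tt_ne (s : Fin n → G) (hb : Function.Bijective (bmap s)) (x : Fin n × Bool) :
    tt s x ≠ 0 := by
  intro h
  have := hb.1 (a₁ := .inr (.inl x)) (a₂ := .inl ()) h
  simp at this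

theorem cc_le_of_inj [DecidableEq G] (s : Fin n → G) (k : ℕ)
    (h : Function.Injective (fun x => k • tt s x)) (g : G) : cc s k g ≤ 1 := by
  unfold cc
  rw [Finset.card_le_one]
  intro a ha b hb
  simp only [Finset.mem_filter, Finset.mem_univ, true_and] at ha hb
  exact h (ha.trans hb.symm)

theorem inj1 (s : Fin n → G) (hb : Function.Bijective (bmap s)) :
    Function.Injective (fun x => 1 • tt s x) := by
  simpa using tt_inj s hb

theorem inj2 (s : Fin n → G) (hb : Function.Bijective (bmap s)) :
    Function.Injective (fun x => 2 • tt s x) :=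
  (dbl_inj s hb).comp (tt_inj s hb)

theorem inj4 (s : Fin n → G) (hb : Function.Bijective (bmap s)) :
    Function.Injective (fun x => 4 • tt s x) := by
  have := (dbl_inj s hb).comp (inj2 s hb)
  simpa [Function.comp_def, smul_smul] using this

theorem cc_zero_iff [DecidableEq G] (s : Fin n → G) (k : ℕ) (g : G) :
    cc s k g = 0 ↔ ∀ x, k • tt s x ≠ g := by
  simp [cc, Finset.filter_eq_empty_iff]

theorem cc_pos [DecidableEq G] (s : Fin n → G) (k : ℕ) (g : G) (x) (h : k • tt s x = g) :
    1 ≤ cc s k g := by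
  rw [Nat.one_le_iff_ne_zero, Ne, cc_zero_iff]
  push Not
  exact ⟨x, h⟩

theorem cc_sum [DecidableEq G] (s : Fin n → G) (k : ℕ) : ∑ g, cc s k g = 2 * n := by
  unfold cc
  rw [← Finset.card_eq_sum_card_fiberwise (t := Finset.univ) (by simp)]
  simp [mul_comm]

theorem dbl_ne (s : Fin n → G) (hb : Function.Bijective (bmap s)) (x : Fin n × Bool) :
    2 • tt s x ≠ 0 := by
  intro h
  exact tt_ne s hb x (dbl_inj s hb (by simpa using h))

theorem E2 [DecidableEq G] (s : Fin n → G) (hb : Function.Bijective (bmap s)) (hn : n % 3 = 2)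
    (g : G) : ((∑ y, cc s 1 (g - 2 • tt s y) : ℕ) : ℤ) =
      2 + cc s 3 g - cc s 2 g - (if g = 0 then 2 else 0) := by
  have key : ∀ g : G, 2 + (cc s 3 g : ℤ) - cc s 2 g - (if g = 0 then 2 else 0) ≤
      ((∑ y, cc s 1 (g - 2 • tt s y) : ℕ) : ℤ) := by
    intro g
    have h1 : cc s 3 g ≤ ∑ y, cc s 1 (g - 2 • tt s y) := by
      conv_lhs => rw [cc, Finset.card_filter]
      refine Finset.sum_le_sum fun y _ => ?_
      split_ifs with h
      · refine cc_pos s 1 _ y ?_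
        rw [← h]; abel
      · simp
    have h2 : (3 : ℤ) ∣ ((∑ y, cc s 1 (g - 2 • tt s y) : ℕ) : ℤ) -
        (2 + cc s 3 g - cc s 2 g - (if g = 0 then 2 else 0)) := by
      have := congrArg (fun z => z.coeff g) (T1T2mod s hb hn)
      have e2 : (2 : AddMonoidAlgebra (ZMod 3) G) = ((2 : ℤ) : AddMonoidAlgebra (ZMod 3) G) := by
        simp
      simp only [e2, AddMonoidAlgebra.coeff_sub, AddMonoidAlgebra.coeff_add, Finsupp.sub_apply,
        Finsupp.add_apply, intmul_coeff, int_coeff, GG_coeff, TT_coeff, TTmul_coeff] at this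
      refine (ZMod.intCast_eq_intCast_iff_dvd_sub _ _ 3).1 ?_
      push_cast at this ⊢
      rw [this]
      split_ifs <;> simp
    have h3 := cc_le_of_inj s 2 (inj2 s hb) g
    have h4 : g = 0 → cc s 2 g = 0 := by
      rintro rfl
      rw [cc_zero_iff]
      exact dbl_ne s hb
    split_ifs at * with hg
    · have := h4 hg; omega
    · omega
  have tot : ∑ g : G, (2 + (cc s 3 g : ℤ) - cc s 2 g - (if g = 0 then 2 else 0)) =
      ∑ g : G, ((∑ y, cc s 1 (g - 2 • tt s y) : ℕ) : ℤ) := by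
    have a1 : ∑ g : G, (cc s 3 g : ℤ) = 2 * n := by exact_mod_cast cc_sum s 3
    have a2 : ∑ g : G, (cc s 2 g : ℤ) = 2 * n := by exact_mod_cast cc_sum s 2
    have a3 : ∑ g : G, ((∑ y, cc s 1 (g - 2 • tt s y) : ℕ) : ℤ) = 4 * n ^ 2 := by
      push_cast
      rw [Finset.sum_comm]
      have : ∀ y, ∑ g : G, (cc s 1 (g - 2 • tt s y) : ℤ) = 2 * n := by
        intro y
        have h := cc_sum s 1
        rw [← Equiv.sum_comp (Equiv.subRight (2 • tt s y))] at h
        exact_mod_cast h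
      simp only [this]
      simp
      ring
    rw [a3]
    simp only [Finset.sum_sub_distrib, Finset.sum_add_distrib, a1, a2]
    simp [cardG s hb]
    ring
  exact ((Finset.sum_eq_sum_iff_of_le (fun g _ => key g)).1 tot g (Finset.mem_univ _)).symm

theorem E3 (s : Fin n → G) (hb : Function.Bijective (bmap s)) (hn : n % 3 = 2) :
    TT ℤ s 1 * TT ℤ s 2 = 2 * GG G ℤ + TT ℤ s 3 - TT ℤ s 2 - 2 := by
  classical
  ext g
  have e2 : (2 : AddMonoidAlgebra ℤ G) = ((2 : ℤ) : AddMonoidAlgebra ℤ G) := by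
    simp
  simp only [e2, AddMonoidAlgebra.coeff_sub, AddMonoidAlgebra.coeff_add, Finsupp.sub_apply,
        Finsupp.add_apply, intmul_coeff, int_coeff, GG_coeff, TT_coeff, TTmul_coeff]
  have := E2 s hb hn g
  push_cast at this ⊢
  linarith

theorem E4 [DecidableEq G] (s : Fin n → G) (hb : Function.Bijective (bmap s)) (hn : n % 3 = 2)
    (g : G) : ((∑ y, cc s 1 (g - 3 • tt s y) : ℕ) : ℤ) =
      (if g = 0 then 2 * (n : ℤ) else 0) + 2 * cc s 1 g + (2 * n - 3) * cc s 2 g - cc s 3 g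
        + cc s 4 g := by
  have h : TT ℤ s 1 * TT ℤ s 3 = ((2 * n : ℤ) : AddMonoidAlgebra ℤ G) +
     ((2 : ℤ) : AddMonoidAlgebra ℤ G) * TT ℤ s 1 + ((2 * n - 3 : ℤ) : AddMonoidAlgebra ℤ G) *
       TT ℤ s 2 - TT ℤ s 3 + TT ℤ s 4 := by
    have h1 := T1sq s hb ℤ
    have h2 := T2sq s hb ℤ
    have h3 := E3 s hb hn
    have g1 := TTGG ℤ s 1
    have g2 := TTGG ℤ s 2
    rw [← g1] at g2
    push_cast
    generalize TT ℤ s 1 = T at *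
    generalize TT ℤ s 2 = T2 at *
    generalize TT ℤ s 3 = T3 at *
    generalize TT ℤ s 4 = T4 at *
    generalize GG G ℤ = Gm at *
    linear_combination (-T - 1) * h3 - T2 * h1 - h2 + 2 * g2
  have := congrArg (fun z => z.coeff g) h
  simp only [AddMonoidAlgebra.coeff_sub, AddMonoidAlgebra.coeff_add, Finsupp.sub_apply,
        Finsupp.add_apply, intmul_coeff, int_coeff, TT_coeff, TTmul_coeff] at this
  push_cast at this ⊢
  exact this

theorem E5 [DecidableEq G] (s : Fin n → G) (hb : Function.Bijective (bmap s))
    (g : G) : ((∑ y, cc s 1 (g - tt s y) : ℕ) : ℤ) =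
      2 - 2 * cc s 1 g + cc s 2 g + (if g = 0 then 2 * (n : ℤ) - 2 else 0) := by
  have h : TT ℤ s 1 * TT ℤ s 1 = ((2 * n - 2 : ℤ) : AddMonoidAlgebra ℤ G) -
     ((2 : ℤ) : AddMonoidAlgebra ℤ G) * TT ℤ s 1 + ((2 : ℤ) : AddMonoidAlgebra ℤ G) *
       GG G ℤ + TT ℤ s 2 := by
    have h1 := T1sq s hb ℤ
    push_cast
    linear_combination -h1
  have := congrArg (fun z => z.coeff g) h
  simp only [AddMonoidAlgebra.coeff_sub, AddMonoidAlgebra.coeff_add, Finsupp.sub_apply,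
        Finsupp.add_apply, intmul_coeff, int_coeff, TT_coeff, TTmul_coeff, GG_coeff,
        one_smul] at this
  push_cast at this ⊢
  linarith

/-- All elements are killed by 3. -/
theorem tors (s : Fin n → G) (hb : Function.Bijective (bmap s)) (hn : n % 3 = 2)
    (h7 : 7 ≤ n) (x : Fin n × Bool) : 3 • tt s x = 0 := by
  classical
  have hA : ∀ x y, tt s x + 2 • tt s y = 0 → 3 • tt s y = 0 := by
    intro x y hxy
    by_contra hne
    have h := E2 s hb hn 0
    have c20 : cc s 2 0 = 0 := by
      rw [cc_zero_iff]
      exact dbl_ne s hb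
    rw [c20] at h
    simp only [if_true] at h
    have h1 : cc s 3 0 < ∑ y, cc s 1 (0 - 2 • tt s y) := by
      conv_lhs => rw [cc, Finset.card_filter]
      refine Finset.sum_lt_sum (fun y _ => ?_) ⟨y, Finset.mem_univ _, ?_⟩
      · split_ifs with h
        · refine cc_pos s 1 _ y ?_
          rw [← h]; abel
        · simp
      · rw [if_neg hne]
        refine cc_pos s 1 _ x ?_
        rw [one_smul, zero_sub]; exact eq_neg_of_add_eq_zero_left hxy
    omega
  have hB : ∀ y, 3 • tt s y ≠ 0 → ∃ x, tt s x = 3 • tt s y := by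
    have h := E4 s hb hn 0
    have c10 : cc s 1 0 = 0 := by
      rw [cc_zero_iff]
      simpa using tt_ne s hb
    have c20 : cc s 2 0 = 0 := by
      rw [cc_zero_iff]
      exact dbl_ne s hb
    have c40 : cc s 4 0 = 0 := by
      rw [cc_zero_iff]
      intro x hx
      exact dbl_ne s hb x (dbl_inj s hb (by simpa [smul_smul] using hx))
    rw [c10, c20, c40] at h
    simp only [if_true] at h
    have h1 : ∑ y, (cc s 1 (0 - 3 • tt s y) + if 3 • tt s y = 0 then 1 else 0) =
        ∑ y : Fin n × Bool, 1 := by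
      rw [Finset.sum_add_distrib, ← Finset.card_filter]
      change _ + cc s 3 0 = _
      simp only [Finset.sum_const, smul_eq_mul, mul_one, Finset.card_univ, Fintype.card_prod,
        Fintype.card_fin, Fintype.card_bool]
      omega
    have h2 := (Finset.sum_eq_sum_iff_of_le (fun y _ => by
      split_ifs with h
      · rw [h, sub_zero, c10]
      · exact cc_le_of_inj s 1 (inj1 s hb) _)).1 h1
    intro y hy
    have := h2 y (Finset.mem_univ _)
    rw [if_neg hy] at this
    have : cc s 1 (0 - 3 • tt s y) ≠ 0 := by omega
    rw [Ne, cc_zero_iff] at this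
    push Not at this
    obtain ⟨x, hx⟩ := this
    refine ⟨ng x, ?_⟩
    rw [tt_ng]
    simpa using congrArg (fun z => -z) hx
  by_contra hx
  have hlt : tt s (ng x) = - tt s x := tt_ng s x
  have c1 : ∀ y, tt s y ≠ 2 • tt s x := by
    intro y hy
    apply hx
    have := hA y (ng x) (by rw [hlt, hy]; abel)
    rw [hlt] at this
    simpa using this
  have c1' : cc s 1 (2 • tt s x) = 0 := by
    rw [cc_zero_iff]; simpa using c1
  have c2 : cc s 2 (2 • tt s x) = 1 :=
    le_antisymm (cc_le_of_inj s 2 (inj2 s hb) _) (cc_pos s 2 _ x rfl)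
  have c3 : cc s 3 (2 • tt s x) = 0 := by
    rw [cc_zero_iff]
    intro y hy
    obtain ⟨z, hz⟩ := hB y (by rw [hy]; exact dbl_ne s hb x)
    exact c1 z (hz.trans hy)
  obtain ⟨w, hw⟩ := hB x hx
  -- the set of representations of 2t
  have hZ := E5 s hb (2 • tt s x)
  rw [c1', c2, if_neg (dbl_ne s hb x)] at hZ
  have n1 : x ≠ ng x := by
    intro h
    have := congrArg (tt s) h
    rw [hlt] at this
    apply dbl_ne s hb x
    rw [two_smul]; nth_rewrite 1 [this]; simp
  have n2 : w ≠ x := by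
    rintro rfl
    apply dbl_ne s hb w
    have : 3 • tt s w = 2 • tt s w + tt s w := by abel
    rw [this] at hw
    simpa using hw
  have n3 : w ≠ ng x := by
    rintro rfl
    rw [hlt] at hw
    have h3 : 3 • tt s x + tt s x = 0 := by rw [← hw]; simp
    have h4 : 2 • (2 • tt s x) = 2 • (0 : G) := by rw [smul_zero, ← h3]; abel
    exact dbl_ne s hb x (dbl_inj s hb h4)
  have n4 : w ≠ ng w := by
    intro h
    have := congrArg (tt s) h
    rw [tt_ng] at this
    apply dbl_ne s hb w
    rw [two_smul]; nth_rewrite 1 [this]; simp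
  have n5 : ng w ≠ x := by
    rintro rfl
    apply n3
    simp [ng]
  have n6 : ng w ≠ ng x := by
    intro h
    apply n2
    have := congrArg ng h
    simpa [ng] using this
  have hZ' : ∀ z, z ≠ x → z ≠ ng x → z ≠ w → cc s 1 (2 • tt s x - tt s z) = 0 := by
    intro z z1 z2 z3
    have hle : ∑ y ∈ ({x, ng x, w, z} : Finset _), cc s 1 (2 • tt s x - tt s y) ≤
        ∑ y, cc s 1 (2 • tt s x - tt s y) :=
      Finset.sum_le_sum_of_subset (Finset.subset_univ _)
    rw [Finset.sum_insert (by simp [n1, n2.symm, z1.symm]),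
      Finset.sum_insert (by simp [n3.symm, z2.symm]),
      Finset.sum_insert (by simp [z3.symm]), Finset.sum_singleton] at hle
    have p1 : 1 ≤ cc s 1 (2 • tt s x - tt s x) := cc_pos s 1 _ x (by abel)
    have p2 : 1 ≤ cc s 1 (2 • tt s x - tt s (ng x)) := cc_pos s 1 _ w (by
      rw [hlt, one_smul, hw]; abel)
    have p3 : 1 ≤ cc s 1 (2 • tt s x - tt s w) := cc_pos s 1 _ (ng x) (by
      rw [hlt, one_smul, hw]; abel)
    omega
  -- main bound
  have hM := E4 s hb hn (2 • tt s x)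
  rw [c1', c2, c3, if_neg (dbl_ne s hb x)] at hM
  have hU : ∑ y, cc s 1 (2 • tt s x - 3 • tt s y) ≤
      ∑ y, ((if 3 • tt s y = tt s x then 1 else 0) + (if 3 • tt s y = tt s (ng x) then 1 else 0)
        + (if 3 • tt s y = tt s w then 1 else 0)) := by
    refine Finset.sum_le_sum fun y _ => ?_
    have l1 := cc_le_of_inj s 1 (inj1 s hb) (2 • tt s x - 3 • tt s y)
    by_cases h0 : 3 • tt s y = 0
    · rw [h0, sub_zero, c1']; simp
    · obtain ⟨z, hz⟩ := hB y h0
      rw [← hz] at l1 ⊢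
      by_cases z1 : z = x
      · rw [if_pos (by rw [z1])]; omega
      by_cases z2 : z = ng x
      · rw [if_pos (c := tt s z = tt s (ng x)) (by rw [z2])]; omega
      by_cases z3 : z = w
      · rw [if_pos (c := tt s z = tt s w) (by rw [z3])]; omega
      rw [hZ' z z1 z2 z3]; simp
  rw [Finset.sum_add_distrib, Finset.sum_add_distrib, ← Finset.card_filter,
    ← Finset.card_filter, ← Finset.card_filter] at hU
  change _ ≤ cc s 3 (tt s x) + cc s 3 (tt s (ng x)) + cc s 3 (tt s w) at hU
  have hsym : ∀ z, cc s 3 (tt s z) ≤ cc s 3 (tt s (ng z)) := by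
    intro z
    unfold cc
    refine Finset.card_le_card_of_injOn ng ?_ ?_
    · intro y hy
      simp only [Finset.coe_filter, Finset.mem_univ, true_and, Set.mem_ofPred_eq] at hy ⊢
      rw [tt_ng, tt_ng, ← hy]; simp
    · intro a _ b _ hab
      have := congrArg ng hab
      simpa [ng] using this
  have ngng : ∀ z : Fin n × Bool, ng (ng z) = z := by intro z; simp [ng]
  have s1 := hsym x
  have s1' := hsym (ng x)
  rw [ngng] at s1'
  have s2 := hsym w
  have h4 : ∑ z ∈ ({x, ng x, w, ng w} : Finset _), cc s 3 (tt s z) ≤ 2 * n := by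
    rw [← cc_sum s 3, ← Finset.sum_image (f := cc s 3) (g := tt s)
      (fun a _ b _ h => tt_inj s hb h)]
    exact Finset.sum_le_sum_of_subset (Finset.subset_univ _)
  rw [Finset.sum_insert (by simp [n1, n2.symm, n5.symm]),
      Finset.sum_insert (by simp [n3.symm, n6.symm]),
      Finset.sum_insert (by simp [n4]), Finset.sum_singleton] at h4
  have hS := E4 s hb hn (tt s x)
  have d1 : cc s 1 (tt s x) ≤ 1 := cc_le_of_inj s 1 (inj1 s hb) _
  have d4 : cc s 4 (tt s x) ≤ 1 := cc_le_of_inj s 4 (inj4 s hb) _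
  have d2 : cc s 2 (tt s x) = 0 := by
    rw [cc_zero_iff]
    intro y hy
    have := hA (ng x) y (by rw [hlt, hy]; simp)
    apply hx
    rw [← hy, smul_comm, this, smul_zero]
  rw [d2, if_neg (tt_ne s hb x)] at hS
  simp only [Nat.cast_one, Nat.cast_zero, mul_one, mul_zero] at *
  omega
end ring

theorem core {G : Type} [AddCommGroup G] [Fintype G] {n : ℕ} (s : Fin n → G)
    (hb : Function.Bijective (bmap s)) (hn : n % 3 = 2) (h7 : 7 ≤ n) : n = 11 := by
  classical
  have h3 := tors s hb hn h7
  have hG : ∀ g : G, 3 • g = 0 := by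
    intro g
    obtain ⟨b, rfl⟩ := hb.2 g
    rcases b with _ | x | p
    · simp [bmap]
    · exact h3 x
    · simp [bmap, h3]
  have hcard := cardG s hb
  have hp : ∀ p : ℕ, p.Prime → p ∣ 2 * n ^ 2 + 1 → p = 3 := by
    intro p hp hd
    have : Fact p.Prime := ⟨hp⟩
    rw [← hcard] at hd
    obtain ⟨g, hg⟩ := exists_prime_addOrderOf_dvd_card p hd
    have h1 : p ∣ 3 := by
      rw [← hg]; exact addOrderOf_dvd_of_nsmul_eq_zero (hG g)
    exact (Nat.prime_dvd_prime_iff_eq hp Nat.prime_three).1 h1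
  have hneg : ∀ g : G, 2 • g = -g := by
    intro g
    have : 2 • g + g = 0 := by rw [← hG g]; abel
    exact eq_neg_of_add_eq_zero_left this
  have hr : ∀ χ : AddChar G ℂ, ∃ r : ℤ, ∑ x, χ (tt s x) = r := by
    intro χ
    have h : ∀ g : G, ∃ r : ℤ, χ g + χ (-g) = r := by
      intro g
      have e1 : χ g ^ 3 = 1 := by
        rw [← AddChar.map_nsmul_eq_pow, hG, AddChar.map_zero_eq_one]
      have e2 : χ (-g) = χ g ^ 2 := by
        rw [← AddChar.map_nsmul_eq_pow, hneg]
      have e3 : (χ g - 1) * (χ g ^ 2 + χ g + 1) = 0 := by linear_combination e1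
      rcases mul_eq_zero.1 e3 with e | e
      · refine ⟨2, ?_⟩
        rw [e2, sub_eq_zero.1 e]; norm_num
      · refine ⟨-1, ?_⟩
        rw [e2]; push_cast; linear_combination e
    choose r hr using h
    refine ⟨∑ i, r (s i), ?_⟩
    rw [Fintype.sum_prod_type]
    push_cast
    refine Finset.sum_congr rfl fun i _ => ?_
    rw [← hr]
    simp [tt]
  choose r hr using hr
  have hq : ∀ χ : AddChar G ℂ, χ ≠ 0 → r χ ^ 2 + r χ + 2 = 2 * n := by
    intro χ hχ
    have h := hsum s hb (A := ℂ) (fun g => χ g)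
    have h0 : ∑ g, χ g = 0 := by
      rw [AddChar.sum_eq_zero_iff_ne_zero]; exact hχ
    have h2 : ∑ x, χ (2 • tt s x) = r χ := by
      rw [← hr]
      simp only [hneg]
      simp [Fintype.sum_prod_type, tt, add_comm]
    have h4 : ∑ x, ∑ y, χ (tt s x + tt s y) = (r χ : ℂ) ^ 2 := by
      simp only [AddChar.map_add_eq_mul]
      rw [← Finset.sum_mul_sum, hr, sq]
    simp only [h0, h2, h4, hr, AddChar.map_zero_eq_one] at h
    have : ((r χ ^ 2 + r χ + 2 : ℤ) : ℂ) = ((2 * n : ℤ) : ℂ) := by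
      push_cast; linear_combination -h
    exact_mod_cast this
  have hr0 : r 0 = 2 * n := by
    have := hr 0
    simp [Fintype.card_prod] at this
    have h' : ((n * 2 : ℤ) : ℂ) = (r 0 : ℂ) := by push_cast; exact this
    have := Int.cast_injective h'
    linarith
  have htot : ∑ χ : AddChar G ℂ, r χ = 0 := by
    have : ((∑ χ : AddChar G ℂ, r χ : ℤ) : ℂ) = 0 := by
      push_cast
      simp only [← hr]
      rw [Finset.sum_comm]
      refine Finset.sum_eq_zero fun x _ => ?_
      rw [AddChar.sum_apply_eq_ite, if_neg (tt_ne s hb x)]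
    exact_mod_cast this
  have hc : Fintype.card (AddChar G ℂ) = 2 * n ^ 2 + 1 := by rw [AddChar.card_eq, hcard]
  have : Nontrivial (AddChar G ℂ) := by
    rw [← Fintype.one_lt_card_iff_nontrivial, hc]
    have : 0 < n ^ 2 := by positivity
    omega
  obtain ⟨χ₀, hχ₀⟩ := exists_ne (0 : AddChar G ℂ)
  have q0 := hq χ₀ hχ₀
  generalize r χ₀ = ρ at q0
  have hd : ∀ χ : AddChar G ℂ, χ ≠ 0 → (2 * ρ + 1) ∣ r χ - ρ := by
    intro χ hχ
    have := hq χ hχ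
    have e : (r χ - ρ) * (r χ + ρ + 1) = 0 := by linear_combination this - q0
    rcases mul_eq_zero.1 e with e | e
    · rw [e]; exact dvd_zero _
    · exact ⟨-1, by linarith⟩
  have hs : ∑ χ ∈ Finset.univ.erase (0 : AddChar G ℂ), (r χ - ρ) = -2 * n - 2 * n ^ 2 * ρ := by
    have h1 : ∑ χ : AddChar G ℂ, (r χ - ρ) = - (2 * n ^ 2 + 1) * ρ := by
      rw [Finset.sum_sub_distrib, htot]
      rw [Finset.sum_const, Finset.card_univ, hc, nsmul_eq_mul]
      push_cast
      ring
    rw [← Finset.add_sum_erase _ _ (Finset.mem_univ (0 : AddChar G ℂ)), hr0] at h1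
    linarith
  have hdd : (2 * ρ + 1) ∣ -2 * n - 2 * n ^ 2 * ρ := by
    rw [← hs]
    exact Finset.dvd_sum fun χ hχ => hd χ (Finset.ne_of_mem_erase hχ)
  have h126 : (2 * ρ + 1) ∣ 126 := by
    obtain ⟨k, hk⟩ := hdd
    have hsq : 8 * (n : ℤ) = (2 * ρ + 1) ^ 2 + 7 := by linear_combination -4 * q0
    generalize hD : 2 * ρ + 1 = D at *
    have hρ : 2 * ρ = D - 1 := by linarith
    have a : 4 * (n : ℤ) - 2 * n ^ 2 = D * (-2 * k - 2 * n ^ 2) := by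
      linear_combination -2 * hk - 2 * (n : ℤ) ^ 2 * hρ
    refine ⟨64 * (-2 * k - 2 * n ^ 2) - 32 * D + 2 * D ^ 3 + 28 * D, ?_⟩
    linear_combination 64 * a + (-32 + 2 * (8 * n + D ^ 2 + 7)) * hsq
  have hsq : ((2 * ρ + 1).natAbs : ℤ) ^ 2 + 7 = 8 * n := by
    rw [Int.natAbs_sq]; linear_combination 4 * q0
  have hmem : (2 * ρ + 1).natAbs ∈ Nat.divisors 126 := by
    rw [Nat.mem_divisors]
    exact ⟨by simpa using Int.natAbs_dvd_natAbs.2 h126, by norm_num⟩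
  generalize (2 * ρ + 1).natAbs = D at *
  have hdiv : Nat.divisors 126 = {1, 2, 3, 6, 7, 9, 14, 18, 21, 42, 63, 126} := by decide +kernel
  rw [hdiv] at hmem
  have h56 : n ≠ 56 := by
    rintro rfl
    have := hp 17 (by norm_num) (by norm_num)
    omega
  have h497 : n ≠ 497 := by
    rintro rfl
    have := hp 19 (by norm_num) (by norm_num)
    omega
  simp only [Finset.mem_insert, Finset.mem_singleton] at hmem
  rcases hmem with h | h | h | h | h | h | h | h | h | h | h | h <;> subst h <;>
    norm_num at hsq <;> omega

theorem stmt6 (n : ℕ) (hn : 3 ≤ n) (hmod : n % 3 = 2) (h5 : n ≠ 5) (h11 : n ≠ 11) :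
    ¬ ∃ L : AddSubgroup (Fin n → ℤ), IsLatticeTiling n (errBall n) L := by
  rintro ⟨L, hL⟩
  have hb := bmap_bij n L (errBall n) rfl hL
  have : Finite ((Fin n → ℤ) ⧸ L) := Finite.of_surjective _ hb.2
  have : Fintype ((Fin n → ℤ) ⧸ L) := Fintype.ofFinite _
  exact h11 (core _ hb hmod (by omega))
end

section
/- Let n ≥ 3 be an integer with n ≡ 6 (mod 15). Then there is no lattice tiling of ℤⁿ by the error ball B(n,2,1,1). -/
set_option linter.unusedSectionVars false

noncomputable def grpE {G : Type} [AddCommGroup G] (A : Finset G) (k : ℕ) : AddMonoidAlgebra ℤ G :=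
  ∑ a ∈ A, AddMonoidAlgebra.single (k • a) 1

noncomputable def grpAll (G : Type) [AddCommGroup G] [Fintype G] : AddMonoidAlgebra ℤ G :=
  ∑ g : G, AddMonoidAlgebra.single g 1

section grp
variable {G : Type} [AddCommGroup G] [Fintype G] [DecidableEq G]

lemma grpE_coeff (A : Finset G) (k : ℕ) (hk : Function.Injective (fun g : G => k • g)) (g : G) :
    (grpE A k).coeff g = if g ∈ A.image (fun g : G => k • g) then 1 else 0 := by
  have : grpE A k = ∑ b ∈ A.image (fun g : G => k • g), AddMonoidAlgebra.single b 1 := by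
    rw [Finset.sum_image (fun x _ y _ h => hk h)]; rfl
  rw [this]
  simp [AddMonoidAlgebra.coeff_sum, Finsupp.finsetSum_apply, Finsupp.single_apply]

lemma grpAll_coeff (g : G) : (grpAll G).coeff g = 1 := by
  simp [grpAll, AddMonoidAlgebra.coeff_sum, Finsupp.finsetSum_apply, Finsupp.single_apply]

lemma grpAll_mul_single (h : G) : grpAll G * AddMonoidAlgebra.single h 1 = grpAll G := by
  unfold grpAll
  rw [Finset.sum_mul]
  simp only [AddMonoidAlgebra.single_mul_single, mul_one]
  exact Fintype.sum_equiv (Equiv.addRight h) _ _ (fun _ => rfl)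

lemma grpAll_mul_grpE (A : Finset G) (k : ℕ) :
    grpAll G * grpE A k = (A.card : ℤ) * grpAll G := by
  unfold grpE
  rw [Finset.mul_sum, Finset.sum_congr rfl (fun a _ => grpAll_mul_single (k • a))]
  simp

lemma grpAll_mul_grpAll :
    grpAll G * grpAll G = (Fintype.card G : ℤ) * grpAll G := by
  conv_lhs => enter [2]; unfold grpAll
  rw [Finset.mul_sum, Finset.sum_congr rfl (fun a _ => grpAll_mul_single a)]
  simp

lemma coeff_int_mul (z : ℤ) (x : AddMonoidAlgebra ℤ G) (g : G) :
    ((z : AddMonoidAlgebra ℤ G) * x).coeff g = z * x.coeff g := by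
  rw [← zsmul_eq_mul, AddMonoidAlgebra.coeff_smul]; simp

lemma coeff_int_zero (z : ℤ) :
    ((z : AddMonoidAlgebra ℤ G)).coeff 0 = z := by
  have := coeff_int_mul z (1 : AddMonoidAlgebra ℤ G) 0
  rw [mul_one] at this
  rw [this, AddMonoidAlgebra.one_def]; simp

noncomputable def grpMap (G : Type) [AddCommGroup G] (j : ℤ) :
    AddMonoidAlgebra ℤ G →+* AddMonoidAlgebra ℤ G :=
  AddMonoidAlgebra.mapDomainRingHom ℤ (zsmulAddGroupHom j : G →+ G)

lemma grpMap_single (j : ℤ) (g : G) (r : ℤ) :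
    grpMap G j (AddMonoidAlgebra.single g r) = AddMonoidAlgebra.single (j • g) r := by
  simp [grpMap]

lemma grpMap_grpE (A : Finset G) (j k : ℕ) : grpMap G j (grpE A k) = grpE A (j * k) := by
  unfold grpE
  rw [map_sum]
  refine Finset.sum_congr rfl fun a _ => ?_
  rw [grpMap_single, mul_smul]; simp

lemma grpMap_neg_grpE (A : Finset G) (hA : ∀ a ∈ A, -a ∈ A) (k : ℕ) :
    grpMap G (-1) (grpE A k) = grpE A k := by
  unfold grpE
  rw [map_sum]
  refine Finset.sum_bij' (fun a _ => -a) (fun a _ => -a) hA hA (by simp) (by simp) ?_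
  intro a _
  rw [grpMap_single]; simp

lemma grpMap_grpAll (j : ℕ) (hj : Function.Injective (fun g : G => j • g)) :
    grpMap G j (grpAll G) = grpAll G := by
  unfold grpAll
  rw [map_sum]
  refine Fintype.sum_bijective (fun g : G => j • g) (Finite.injective_iff_bijective.1 hj) _ _ ?_
  intro a
  rw [grpMap_single]; simp

lemma grpMap_coeff (j : ℤ) (hj : Function.Injective (fun g : G => j • g))
    (x : AddMonoidAlgebra ℤ G) (g : G) : (grpMap G j x).coeff (j • g) = x.coeff g := by
  exact Finsupp.mapDomain_apply hj x.coeff g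

lemma grp_frob (A : Finset G) (p : ℕ) (hp : p.Prime) :
    ∃ D : AddMonoidAlgebra ℤ G, grpE A 1 ^ p = grpE A p + ((p : ℤ) : AddMonoidAlgebra ℤ G) * D := by
  unfold grpE
  induction A using Finset.induction_on with
  | empty => exact ⟨0, by simp [hp.ne_zero]⟩
  | insert a s ha ih =>
    obtain ⟨D, hD⟩ := ih
    rw [Finset.sum_insert ha, Finset.sum_insert ha]
    obtain ⟨r, hr⟩ := exists_add_pow_prime_eq hp (AddMonoidAlgebra.single (1 • a) (1:ℤ))
      (∑ a ∈ s, AddMonoidAlgebra.single (1 • a) (1:ℤ))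
    rw [hr, hD, AddMonoidAlgebra.single_pow]
    refine ⟨D + AddMonoidAlgebra.single (1 • a) (1:ℤ) * (∑ a ∈ s, AddMonoidAlgebra.single (1 • a) (1:ℤ)) * r, ?_⟩
    simp only [one_smul, one_pow]
    push_cast
    ring

lemma grp_sum_coeff (A : Finset G) (k : ℕ) :
    ∑ g, (grpE A 1 * grpE A k).coeff g = (A.card : ℤ) ^ 2 := by
  unfold grpE
  rw [Finset.sum_mul_sum]
  simp only [AddMonoidAlgebra.coeff_sum, Finsupp.finsetSum_apply,
    AddMonoidAlgebra.single_mul_single, AddMonoidAlgebra.coeff_single]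
  rw [Finset.sum_comm]
  simp_rw [Finset.sum_comm (s := (Finset.univ : Finset G))]
  simp [Finsupp.single_apply, sq]

lemma grp_coeff_nonneg (A : Finset G) (k : ℕ) (g : G) :
    0 ≤ (grpE A 1 * grpE A k).coeff g := by
  unfold grpE
  rw [Finset.sum_mul_sum]
  simp only [AddMonoidAlgebra.coeff_sum, Finsupp.finsetSum_apply,
    AddMonoidAlgebra.single_mul_single, AddMonoidAlgebra.coeff_single]
  refine Finset.sum_nonneg fun a _ => Finset.sum_nonneg fun b _ => ?_
  rw [Finsupp.single_apply]; split_ifs <;> simp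

lemma grp_coeff_zero (A : Finset G) (hA : ∀ a ∈ A, -a ∈ A) (k : ℕ) :
    (grpE A 1 * grpE A k).coeff 0 = ((A.filter (fun b => k • b ∈ A)).card : ℤ) := by
  unfold grpE
  rw [Finset.sum_mul_sum, Finset.sum_comm]
  simp only [AddMonoidAlgebra.coeff_sum, Finsupp.finsetSum_apply,
    AddMonoidAlgebra.single_mul_single, AddMonoidAlgebra.coeff_single]
  rw [Finset.card_filter]
  push_cast
  refine Finset.sum_congr rfl fun b _ => ?_
  have : ∀ a : G, (a + k • b = 0) ↔ (-(k • b)) = a := by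
    intro a
    constructor
    · intro h; exact neg_eq_of_add_eq_zero_left h
    · intro h; rw [← h]; simp
  simp only [one_smul, mul_one, Finsupp.single_apply]
  have h2 : (k • b ∈ A) ↔ (-(k • b) ∈ A) := ⟨hA _, fun h => by simpa using hA _ h⟩
  simp [this, h2]

lemma grp_sq (x : AddMonoidAlgebra ℤ G) (hx : grpMap G (-1) x = x) :
    (x * x).coeff 0 = ∑ g, x.coeff g ^ 2 := by
  rw [AddMonoidAlgebra.coeff_mul, Finsupp.sum_fintype _ _ (by intro i; simp)]
  refine Finset.sum_congr rfl fun g _ => ?_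
  rw [Finsupp.sum_fintype _ _ (by intro i; simp)]
  have : ∀ a : G, (g + a = 0) ↔ a = -g := by
    intro a
    constructor
    · intro h; exact eq_neg_of_add_eq_zero_right h
    · intro h; rw [h]; simp
  simp only [this, Finset.sum_ite_eq', Finset.mem_univ, if_true]
  have := grpMap_coeff (-1) (by intro a b h; simpa using h) x g
  rw [hx] at this
  rw [sq]; congr 1; simpa using this

lemma grp_inj (k : ℕ) (h : (Fintype.card G).Coprime k) :
    Function.Injective (fun g : G => k • g) := by
  rw [← Nat.card_eq_fintype_card] at h
  exact (nsmulCoprime h).injective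

lemma grp_E_zero (A : Finset G) (h0 : (0:G) ∈ A) (k : ℕ)
    (hk : Function.Injective (fun g : G => k • g)) : (grpE A k).coeff 0 = 1 := by
  rw [grpE_coeff A k hk, if_pos]
  exact Finset.mem_image.2 ⟨0, h0, by simp⟩

lemma grp_Esq (n : ℕ) (A : Finset G)
    (heq : grpE A 1 ^ 2 = 2 * grpAll G + grpE A 2 + ((2 * n - 2 : ℤ) : AddMonoidAlgebra ℤ G))
    (k : ℕ) (hk : Function.Injective (fun g : G => k • g)) :
    grpE A k ^ 2 = 2 * grpAll G + grpE A (k * 2) + ((2 * n - 2 : ℤ) : AddMonoidAlgebra ℤ G) := by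
  have := congrArg (grpMap G (k : ℤ)) heq
  rw [map_pow, map_add, map_add, map_mul, grpMap_grpE, grpMap_grpE, grpMap_grpAll k hk, map_intCast,
    map_ofNat, mul_one] at this
  exact this

lemma grp_sumsq (n : ℕ) (A : Finset G) (hA : A.card = 2 * n + 1)
    (hG : Fintype.card G = 2 * n ^ 2 + 1) (h0 : (0:G) ∈ A) (hneg : ∀ a ∈ A, -a ∈ A)
    (heq : grpE A 1 ^ 2 = 2 * grpAll G + grpE A 2 + ((2 * n - 2 : ℤ) : AddMonoidAlgebra ℤ G))
    (k : ℕ) (hk : Function.Injective (fun g : G => k • g))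
    (h2 : Function.Injective (fun g : G => 2 • g)) :
    ∑ g, (grpE A 1 * grpE A k).coeff g ^ 2
      = 12 * (n:ℤ) ^ 2 + 12 * n + (grpE A 1 * grpE A k).coeff 0 := by
  have hk2 : Function.Injective (fun g : G => (k * 2) • g) := by
    intro a b h
    simp only [mul_smul] at h
    exact h2 (hk h)
  rw [← grp_sq _ (by rw [map_mul, grpMap_neg_grpE A hneg, grpMap_neg_grpE A hneg])]
  have e1 : (grpE A 1 * grpE A k) * (grpE A 1 * grpE A k)
      = ((8 * n ^ 2 + 16 * n : ℤ) : AddMonoidAlgebra ℤ G) * grpAll G + grpE A 2 * grpE A (k * 2)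
       + ((2 * n - 2 : ℤ) : AddMonoidAlgebra ℤ G) * grpE A 2
       + ((2 * n - 2 : ℤ) : AddMonoidAlgebra ℤ G) * grpE A (k * 2)
       + (((2 * n - 2) ^ 2 : ℤ) : AddMonoidAlgebra ℤ G) := by
    have a1 := grp_Esq n A heq k hk
    have a2 := grpAll_mul_grpAll (G := G)
    have a3 := grpAll_mul_grpE A 2
    have a4 := grpAll_mul_grpE A (k * 2)
    rw [hG] at a2
    rw [hA] at a3 a4
    push_cast at *
    calc _ = grpE A 1 ^ 2 * grpE A k ^ 2 := by ring
      _ = _ := by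
        rw [heq, a1]
        linear_combination 4 * a2 + 2 * a3 + 2 * a4
  have e2 : grpE A 2 * grpE A (k * 2) = grpMap G (2 : ℕ) (grpE A 1 * grpE A k) := by
    rw [map_mul, grpMap_grpE, grpMap_grpE, mul_comm k 2]
  have e3 : (grpMap G (2 : ℕ) (grpE A 1 * grpE A k)).coeff 0 = (grpE A 1 * grpE A k).coeff 0 := by
    have := grpMap_coeff (G := G) ((2 : ℕ) : ℤ) (by simpa only [natCast_zsmul] using h2) (grpE A 1 * grpE A k) 0
    rwa [smul_zero] at this
  rw [e1]
  simp only [AddMonoidAlgebra.coeff_add, Finsupp.add_apply, coeff_int_mul, coeff_int_zero,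
    grpAll_coeff, grp_E_zero A h0 2 h2, grp_E_zero A h0 _ hk2]
  rw [e2, e3]
  ring

/-- pure counting step -/
lemma concentrate (S : Finset G) (e : G → ℤ) (k : ℤ) (hk : 0 < k) (he : ∀ g, 0 ≤ e g)
    (hs : ∑ g, e g = k)
    (hq : 5 * ∑ g, e g ^ 2 + 2 * ∑ g ∈ S, e g = 5 * k ^ 2 + k + e 0) : e 0 = k := by
  have hle : ∑ g ∈ S, e g ≤ k := by
    rw [← hs]
    exact Finset.sum_le_sum_of_subset_of_nonneg (Finset.subset_univ _) (fun g _ _ => he g)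
  have hex : ∃ g, k ≤ e g := by
    by_contra! hcon
    have : ∑ g, e g ^ 2 ≤ ∑ g, (k - 1) * e g := by
      refine Finset.sum_le_sum fun g _ => ?_
      nlinarith [he g, hcon g]
    rw [← Finset.mul_sum, hs] at this
    nlinarith [he 0]
  obtain ⟨g, hg⟩ := hex
  have hz : ∀ h, h ≠ g → e h = 0 := by
    intro h hne
    have := Finset.sum_le_sum_of_subset_of_nonneg (Finset.subset_univ {h, g}) (fun g _ _ => he g)
    rw [Finset.sum_pair hne, hs] at this
    linarith [he h]
  have hgk : e g = k := by
    rw [← hs]; symm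
    exact Finset.sum_eq_single g (fun b _ hb => hz b hb) (by simp)
  by_cases hg0 : g = 0
  · rw [← hg0]; exact hgk
  exfalso
  have h1 : ∑ g, e g ^ 2 = k ^ 2 := by
    rw [← hgk]
    exact Finset.sum_eq_single g (fun b _ hb => by rw [hz b hb]; rfl) (by simp)
  rw [h1, hz 0 (fun h => hg0 h.symm)] at hq
  by_cases hgS : g ∈ S
  · have : ∑ g ∈ S, e g = k := by
      rw [← hgk]
      exact Finset.sum_eq_single g (fun b _ hb => hz b hb) (fun h => absurd hgS h)
    rw [this] at hq; linarith
  · have : ∑ g ∈ S, e g = 0 :=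
      Finset.sum_eq_zero (fun b hb => hz b (fun h => hgS (h ▸ hb)))
    rw [this] at hq; linarith

lemma grp_five (n : ℕ) (hn : 3 ≤ n) (hmod : n % 5 = 1) (A : Finset G) (hA : A.card = 2 * n + 1)
    (hG : Fintype.card G = 2 * n ^ 2 + 1) (h0 : (0:G) ∈ A) (hneg : ∀ a ∈ A, -a ∈ A)
    (heq : grpE A 1 ^ 2 = 2 * grpAll G + grpE A 2 + ((2 * n - 2 : ℤ) : AddMonoidAlgebra ℤ G))
    (h2 : Function.Injective (fun g : G => 2 • g))
    (h4 : Function.Injective (fun g : G => 4 • g))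
    (h5 : Function.Injective (fun g : G => 5 • g)) : grpE A 4 = grpE A 1 := by
  obtain ⟨t, rfl⟩ : ∃ t, n = 5 * t + 1 := ⟨n / 5, by omega⟩
  have hA5 : (A.image (fun g : G => 5 • g)).card = A.card := Finset.card_image_of_injective _ h5
  set S := A.image (fun g : G => 5 • g) with hS
  have hcS : ∀ g, (grpE A 5).coeff g = if g ∈ S then 1 else 0 := grpE_coeff A 5 h5
  -- congruence
  obtain ⟨D, hD⟩ := grp_frob A 5 (by norm_num)
  have key : ∃ D' : AddMonoidAlgebra ℤ G, grpE A 1 * grpE A 4 =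
      ((2 : ℤ) : AddMonoidAlgebra ℤ G) * grpAll G + grpE A 5 + ((5 : ℤ) : AddMonoidAlgebra ℤ G) * D' := by
    have a1 := grp_Esq _ A heq 2 h2
    have a2 := grpAll_mul_grpAll (G := G)
    have a3 := grpAll_mul_grpE A 1
    have a4 := grpAll_mul_grpE A 2
    rw [hG] at a2
    rw [hA] at a3 a4
    refine ⟨D - (400 * t ^ 3 + 440 * t ^ 2 + 148 * t + 16) * grpAll G - 2 * t * grpE A 1
      - 20 * t ^ 2 * grpE A 1 - 4 * t * (grpE A 1 * grpE A 2), ?_⟩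
    push_cast at *
    norm_num at a1
    have e4 : grpE A 1 ^ 4 = (2 * grpAll G + grpE A 2 + (10 * t : AddMonoidAlgebra ℤ G)) ^ 2 := by
      rw [show grpE A 1 ^ 4 = (grpE A 1 ^ 2) ^ 2 by ring, heq]; ring
    linear_combination hD - grpE A 1 * e4 - grpE A 1 * a1 - 4 * grpE A 1 * a2 - 4 * grpE A 1 * a4
      - (4 * (50 * t ^ 2 + 20 * t + 3) + 2 + 4 * (10 * t + 3) + 40 * t) * a3
  obtain ⟨E, hE⟩ := key
  have hc : ∀ g, (grpE A 1 * grpE A 4).coeff g = 2 + (if g ∈ S then 1 else 0) + 5 * E.coeff g := by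
    intro g
    rw [hE]
    simp only [AddMonoidAlgebra.coeff_add, Finsupp.add_apply, coeff_int_mul, grpAll_coeff, hcS]
    ring
  have hsum := grp_sum_coeff A 4
  have hsq := grp_sumsq _ A hA hG h0 hneg heq 4 h4 h2
  have hpos := grp_coeff_nonneg A 4
  have h0S : (0 : G) ∈ S := Finset.mem_image.2 ⟨0, h0, by simp⟩
  have hz := grp_coeff_zero A hneg 4
  simp only [hc] at hsum hsq hpos hz
  have hcard : (S.card : ℤ) = 2 * (5 * t + 1) + 1 := by rw [hA5, hA]; push_cast; ring
  have hGz : (Fintype.card G : ℤ) = 2 * (5 * t + 1) ^ 2 + 1 := by rw [hG]; push_cast; ring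
  have hindS : ∑ g : G, (if g ∈ S then (1:ℤ) else 0) = S.card := by simp
  have hs : ∑ g, E.coeff g = 2 * t := by
    rw [Finset.sum_add_distrib, Finset.sum_add_distrib, hindS, ← Finset.mul_sum, hcard, hA] at hsum
    simp only [Finset.sum_const, Finset.card_univ, nsmul_eq_mul, hGz] at hsum
    push_cast at hsum
    linarith
  have hq : 5 * ∑ g, E.coeff g ^ 2 + 2 * ∑ g ∈ S, E.coeff g
      = 5 * (2 * t : ℤ) ^ 2 + (2 * t : ℤ) + E.coeff 0 := by
    have : ∀ g, (2 + (if g ∈ S then (1:ℤ) else 0) + 5 * E.coeff g) ^ 2 =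
      4 + 5 * (if g ∈ S then (1:ℤ) else 0) + 20 * E.coeff g + 25 * E.coeff g ^ 2
        + 10 * (if g ∈ S then E.coeff g else 0) := by
      intro g; split_ifs <;> ring
    simp only [this, Finset.sum_add_distrib, ← Finset.mul_sum, hindS, hs, hcard] at hsq
    simp only [Finset.sum_const, Finset.card_univ, nsmul_eq_mul, hGz, if_pos h0S,
      Finset.sum_ite_mem, Finset.univ_inter] at hsq
    push_cast at hsq
    linarith
  have he : ∀ g, 0 ≤ E.coeff g := by
    intro g
    have := hpos g
    split_ifs at this <;> omega
  have hfin := concentrate S (fun g => E.coeff g) (2 * t) (by omega) he hs hq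
  rw [hfin, if_pos h0S] at hz
  have hfull : A.filter (fun b => 4 • b ∈ A) = A := by
    refine Finset.eq_of_subset_of_card_le (Finset.filter_subset _ _) ?_
    rw [hA]; omega
  have him : A.image (fun g : G => 4 • g) = A := by
    refine Finset.eq_of_subset_of_card_le ?_ (Finset.card_image_of_injective _ h4).ge
    intro x hx
    obtain ⟨b, hb, rfl⟩ := Finset.mem_image.1 hx
    rw [← hfull] at hb
    exact (Finset.mem_filter.1 hb).2
  ext g
  rw [grpE_coeff A 4 h4, grpE_coeff A 1 (by intro a b h; simpa using h), him]
  simp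

lemma grp_three (n : ℕ) (hn : 3 ≤ n) (hmod : n % 3 = 0) (A : Finset G) (hA : A.card = 2 * n + 1)
    (hG : Fintype.card G = 2 * n ^ 2 + 1) (h0 : (0:G) ∈ A) (hneg : ∀ a ∈ A, -a ∈ A)
    (heq : grpE A 1 ^ 2 = 2 * grpAll G + grpE A 2 + ((2 * n - 2 : ℤ) : AddMonoidAlgebra ℤ G))
    (h2 : Function.Injective (fun g : G => 2 • g))
    (h3 : Function.Injective (fun g : G => 3 • g))
    (h41 : grpE A 4 = grpE A 1) : False := by
  obtain ⟨t, rfl⟩ : ∃ t, n = 3 * t := ⟨n / 3, by omega⟩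
  have hA3 : (A.image (fun g : G => 3 • g)).card = A.card := Finset.card_image_of_injective _ h3
  set S := A.image (fun g : G => 3 • g) with hS
  have hcS : ∀ g, (grpE A 3).coeff g = if g ∈ S then 1 else 0 := grpE_coeff A 3 h3
  have hcA : ∀ g, (grpE A 1).coeff g = if g ∈ A then 1 else 0 := by
    intro g
    rw [grpE_coeff A 1 (by intro a b h; simpa using h)]
    simp
  obtain ⟨D, hD⟩ := grp_frob A 3 (by norm_num)
  have hE : grpE A 1 * grpE A 2 = grpE A 3 + ((3 : ℤ) : AddMonoidAlgebra ℤ G) * D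
      - ((12 * t + 2 : ℤ) : AddMonoidAlgebra ℤ G) * grpAll G
      - ((6 * t - 2 : ℤ) : AddMonoidAlgebra ℤ G) * grpE A 1 := by
    have a3 := grpAll_mul_grpE A 1
    rw [hA] at a3
    push_cast at *
    linear_combination hD - grpE A 1 * heq - 2 * a3
  have hc : ∀ g, ∃ z : ℤ, (grpE A 1 * grpE A 2).coeff g =
      1 + (if g ∈ S then 1 else 0) - (if g ∈ A then 1 else 0) + 3 * z := by
    intro g
    rw [hE]
    simp only [AddMonoidAlgebra.coeff_add, AddMonoidAlgebra.coeff_sub, Finsupp.sub_apply,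
      Finsupp.add_apply, coeff_int_mul, grpAll_coeff, hcS, hcA]
    refine ⟨D.coeff g - 4 * t - 1 - (2 * t - 1) * (if g ∈ A then 1 else 0), ?_⟩
    ring
  have hinv : ∀ g, (grpE A 1 * grpE A 2).coeff (2 • g) = (grpE A 1 * grpE A 2).coeff g := by
    intro g
    have := grpMap_coeff (G := G) ((2 : ℕ) : ℤ) (by simpa only [natCast_zsmul] using h2) (grpE A 1 * grpE A 2) g
    rw [map_mul, grpMap_grpE, grpMap_grpE] at this
    norm_num [h41] at this
    rw [← this, mul_comm]
    congr 1
    simp [two_smul]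
  have hsum := grp_sum_coeff A 2
  have hsq := grp_sumsq _ A hA hG h0 hneg heq 2 h2 h2
  have hz := grp_coeff_zero A hneg 2
  set c := fun g => (grpE A 1 * grpE A 2).coeff g with hcdef
  change ∀ g, ∃ z : ℤ, c g = _ at hc
  change ∀ g, c (2 • g) = c g at hinv
  change ∑ g, c g = _ at hsum
  change ∑ g, c g ^ 2 = _ + c 0 at hsq
  change c 0 = _ at hz
  have h0S : (0 : G) ∈ S := Finset.mem_image.2 ⟨0, h0, by simp⟩
  have hsub : (A \ S) ∪ {0} ⊆ A.filter (fun b => 2 • b ∈ A) := by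
    intro g hg
    rw [Finset.mem_union, Finset.mem_sdiff, Finset.mem_singleton] at hg
    rw [Finset.mem_filter]
    rcases hg with ⟨hgA, hgS⟩ | rfl
    · refine ⟨hgA, ?_⟩
      by_contra hcon
      obtain ⟨z, hz⟩ := hc g
      obtain ⟨w, hw⟩ := hc (2 • g)
      rw [hinv] at hw
      rw [if_neg hgS, if_pos hgA] at hz
      rw [if_neg hcon] at hw
      split_ifs at hw <;> omega
    · simpa using h0
  have hy : ((A \ S).card : ℤ) + 1 ≤ c 0 := by
    rw [hz]
    have := Finset.card_le_card hsub
    rw [Finset.card_union_of_disjoint (by simp [h0S]), Finset.card_singleton] at this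
    exact_mod_cast this
  have hyS : (S \ A).card = (A \ S).card := by
    have a1 := Finset.card_sdiff_add_card_inter S A
    have a2 := Finset.card_sdiff_add_card_inter A S
    rw [Finset.inter_comm] at a2
    omega
  have hlow : ∀ g, -2 * ((if g ∈ A \ S then (1:ℤ) else 0) + (if g ∈ S \ A then (1:ℤ) else 0))
      + (if g = 0 then (c 0 - 1) * (c 0 - 4) else 0) ≤ c g ^ 2 - 5 * c g + 4 := by
    intro g
    by_cases hg : g = 0
    · subst hg
      simp only [Finset.mem_sdiff, h0, h0S]
      simp
      nlinarith
    rw [if_neg hg]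
    obtain ⟨z, hz⟩ := hc g
    have hgen : (-2:ℤ) ≤ c g ^ 2 - 5 * c g + 4 := by
      rcases le_or_gt (c g) 2 with h | h
      · nlinarith
      · have : 3 ≤ c g := h
        nlinarith
    by_cases h1 : g ∈ A <;> by_cases h2 : g ∈ S <;> simp [h1, h2] at hz ⊢
    · rw [hz]; rcases le_or_gt z 0 with h | h
      · nlinarith
      · have : 1 ≤ z := h
        nlinarith
    · linarith
    · linarith
    · rw [hz]; rcases le_or_gt z 0 with h | h
      · nlinarith
      · have : 1 ≤ z := h
        nlinarith
  have hfin := Finset.sum_le_sum (fun g (_ : g ∈ (Finset.univ : Finset G)) => hlow g)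
  have hi1 : ∀ T : Finset G, ∑ g : G, (if g ∈ T then (1:ℤ) else 0) = T.card := by intro T; simp
  have hGz : (Fintype.card G : ℤ) = 2 * (3 * t) ^ 2 + 1 := by rw [hG]; push_cast; ring
  simp only [Finset.sum_add_distrib, Finset.sum_sub_distrib, ← Finset.mul_sum, hi1, hsum, hsq,
    hyS, hA, Finset.sum_const, Finset.card_univ, nsmul_eq_mul, hGz, Finset.sum_ite_eq',
    Finset.mem_univ, if_true] at hfin
  push_cast at hfin
  have ht : (1:ℤ) ≤ t := by omega
  nlinarith [sq_nonneg (c 0 - 5)]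

theorem grp_main (n : ℕ) (hn : 3 ≤ n) (hmod : n % 15 = 6) (A : Finset G) (hA : A.card = 2 * n + 1)
    (hG : Fintype.card G = 2 * n ^ 2 + 1) (h0 : (0:G) ∈ A) (hneg : ∀ a ∈ A, -a ∈ A)
    (heq : grpE A 1 ^ 2 = 2 * grpAll G + grpE A 2 + ((2 * n - 2 : ℤ) : AddMonoidAlgebra ℤ G)) :
    False := by
  have c2 : (Fintype.card G).Coprime 2 := by
    rw [hG, Nat.coprime_comm, Nat.Prime.coprime_iff_not_dvd Nat.prime_two]; omega
  have c3 : (Fintype.card G).Coprime 3 := by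
    rw [hG, Nat.coprime_comm, Nat.Prime.coprime_iff_not_dvd Nat.prime_three]
    obtain ⟨t, rfl⟩ : ∃ t, n = 3 * t := ⟨n / 3, by omega⟩
    rw [show 2 * (3 * t) ^ 2 + 1 = 3 * (6 * t ^ 2) + 1 by ring]; omega
  have c5 : (Fintype.card G).Coprime 5 := by
    rw [hG, Nat.coprime_comm, Nat.Prime.coprime_iff_not_dvd Nat.prime_five]
    obtain ⟨t, rfl⟩ : ∃ t, n = 5 * t + 1 := ⟨n / 5, by omega⟩
    rw [show 2 * (5 * t + 1) ^ 2 + 1 = 5 * (10 * t ^ 2 + 4 * t) + 3 by ring]; omega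
  have h2 := grp_inj 2 c2
  have h4 := grp_inj (G := G) 4 (by simpa using c2.pow_right 2)
  exact grp_three n hn (by omega) A hA hG h0 hneg heq h2 (grp_inj 3 c3)
    (grp_five n hn (by omega) A hA hG h0 hneg heq h2 h4 (grp_inj 5 c5))

end grp

lemma sq_sum_pairs {R : Type} [CommRing R] (n : ℕ) (z : Fin n → R) :
    (∑ i, z i) ^ 2 = ∑ i, z i ^ 2
      + 2 * ∑ p : {p : Fin n × Fin n // p.1 < p.2}, z p.1.1 * z p.1.2 := by
  have h1 : ∑ p : {p : Fin n × Fin n // p.1 < p.2}, z p.1.1 * z p.1.2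
      = ∑ i, ∑ j, if i < j then z i * z j else 0 := by
    rw [← Finset.sum_product', Finset.univ_product_univ, ← Finset.sum_filter]
    exact (Finset.sum_subtype (Finset.univ.filter (fun p : Fin n × Fin n => p.1 < p.2))
      (p := fun p => p.1 < p.2) (by simp) (fun p => z p.1 * z p.2)).symm
  have h2 : ∑ p : {p : Fin n × Fin n // p.1 < p.2}, z p.1.1 * z p.1.2
      = ∑ i, ∑ j, if j < i then z i * z j else 0 := by
    rw [h1, Finset.sum_comm]
    refine Finset.sum_congr rfl fun i _ => Finset.sum_congr rfl fun j _ => ?_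
    rw [mul_comm]
  have h3 : ∑ i, z i ^ 2 = ∑ i, ∑ j, if i = j then z i * z j else 0 := by
    simp [sq]
  rw [two_mul]
  nth_rewrite 1 [h1]
  rw [h2, h3, sq, Finset.sum_mul_sum]
  simp only [← Finset.sum_add_distrib]
  refine Finset.sum_congr rfl fun i _ => Finset.sum_congr rfl fun j _ => ?_
  rcases lt_trichotomy i j with h | h | h
  · simp [h, h.ne, h.not_gt]
  · simp [h]
  · simp [h, h.ne', h.not_gt]

def sgB (b : Bool) : ℤ := if b then 1 else -1

lemma sgB_inj {a b : Bool} (h : sgB a = sgB b) : a = b := by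
  cases a <;> cases b <;> simp [sgB] at h ⊢

lemma sgB_ne (a : Bool) : sgB a ≠ 0 := by
  cases a <;> simp [sgB]

lemma sgB_ex {z : ℤ} (h : z = -1 ∨ z = 0 ∨ z = 1) (h0 : z ≠ 0) : ∃ b, sgB b = z := by
  rcases h with h | h | h
  · exact ⟨false, by simp [sgB, h]⟩
  · exact absurd h h0
  · exact ⟨true, by simp [sgB, h]⟩

abbrev BallIdx (n : ℕ) : Type :=
  Option (Fin n × Bool) ⊕ {p : Fin n × Fin n // p.1 < p.2} × Bool × Bool

def bvec (n : ℕ) : BallIdx n → (Fin n → ℤ)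
  | .inl none => 0
  | .inl (some (i, a)) => fun k => if k = i then sgB a else 0
  | .inr (p, a, b) => fun k => if k = p.1.1 then sgB a else if k = p.1.2 then sgB b else 0

lemma bvec_inj (n : ℕ) : Function.Injective (bvec n) := by
  rintro ((_ | ⟨i, a⟩) | ⟨⟨⟨i, j⟩, hij⟩, a, b⟩) ((_ | ⟨i', a'⟩) | ⟨⟨⟨i', j'⟩, hij'⟩, a', b'⟩) h
  · rfl
  · have := congrFun h i'
    simp [bvec, (sgB_ne _).symm] at this
  · have := congrFun h i'
    simp [bvec, (sgB_ne _).symm] at this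
  · have := congrFun h i
    simp [bvec, (sgB_ne _)] at this
  · have := congrFun h i
    simp only [bvec, if_true] at this
    split_ifs at this with h1
    · rw [h1, sgB_inj this]
    · exact absurd this (sgB_ne _)
  · exfalso
    have h1 := congrFun h i'
    have h2 := congrFun h j'
    simp only [bvec, if_true, hij'.ne'] at h1 h2
    have := sgB_ne a'
    have := sgB_ne b'
    simp only at hij'
    grind
  · have := congrFun h i
    simp [bvec, (sgB_ne _)] at this
  · exfalso
    have h1 := congrFun h i
    have h2 := congrFun h j
    simp only [bvec, if_true, hij.ne'] at h1 h2
    have := sgB_ne a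
    have := sgB_ne b
    simp only at hij
    grind
  · have h1 := congrFun h i
    have h2 := congrFun h j
    have h3 := congrFun h i'
    have h4 := congrFun h j'
    simp only [bvec, if_true] at h1 h2 h3 h4
    have := sgB_ne a
    have := sgB_ne b
    have := sgB_ne a'
    have := sgB_ne b'
    simp only at hij hij'
    have hi : i = i' := by grind
    have hj : j = j' := by grind
    subst hi hj
    have ha : a = a' := sgB_inj (by simpa using h1)
    have hb : b = b' := sgB_inj (by simpa [hij.ne'] using h2)
    rw [ha, hb]

lemma sgB_cases (a : Bool) : sgB a = -1 ∨ sgB a = 0 ∨ sgB a = 1 := by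
  cases a <;> simp [sgB]

lemma bvec_mem (n : ℕ) (x : BallIdx n) : bvec n x ∈ errBall n := by
  have key : ∀ (v : Fin n → ℤ) (s : Finset (Fin n)), s.card ≤ 2 → (∀ k, k ∉ s → v k = 0) →
      (Finset.univ.filter (fun i => v i ≠ 0)).card ≤ 2 := by
    intro v s hs hv
    refine le_trans (Finset.card_le_card ?_) hs
    intro k hk
    by_contra hc
    exact (Finset.mem_filter.1 hk).2 (hv k hc)
  rcases x with (_ | ⟨i, a⟩) | ⟨⟨⟨i, j⟩, hij⟩, a, b⟩
  · refine ⟨fun i => Or.inr (Or.inl rfl), key _ ∅ (by simp) (fun _ _ => rfl)⟩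
  · refine ⟨fun k => ?_, key _ {i} (by simp) (fun k hk => ?_)⟩
    · simp only [bvec]; split_ifs
      · exact sgB_cases a
      · simp
    · simp at hk; simp [bvec, hk]
  · refine ⟨fun k => ?_, key _ {i, j} Finset.card_le_two (fun k hk => ?_)⟩
    · simp only [bvec]; split_ifs
      · exact sgB_cases a
      · exact sgB_cases b
      · simp
    · simp at hk; simp [bvec, hk]

lemma bvec_surj (n : ℕ) (v : Fin n → ℤ) (hv : v ∈ errBall n) : ∃ x, bvec n x = v := by
  obtain ⟨h1, h2⟩ := hv
  set s := Finset.univ.filter (fun i => v i ≠ 0) with hs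
  have hm : ∀ k, k ∈ s ↔ v k ≠ 0 := by intro k; simp [hs]
  have h3 : s.card = 0 ∨ s.card = 1 ∨ s.card = 2 := by omega
  have pair : ∀ i j, i < j → s = {i, j} → ∃ x, bvec n x = v := by
    intro i j hij h
    obtain ⟨a, ha⟩ := sgB_ex (h1 i) ((hm i).1 (by simp [h]))
    obtain ⟨b, hb⟩ := sgB_ex (h1 j) ((hm j).1 (by simp [h]))
    refine ⟨.inr (⟨(i, j), hij⟩, a, b), ?_⟩
    funext k
    simp only [bvec]
    split_ifs with e1 e2
    · rw [e1, ha]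
    · rw [e2, hb]
    · have := (hm k).not.1 (by simp [h, e1, e2])
      simpa using Eq.symm (not_not.1 this)
  rcases h3 with h | h | h
  · refine ⟨.inl none, ?_⟩
    rw [Finset.card_eq_zero] at h
    funext k
    have := (hm k).not.1 (by simp [h])
    simpa [bvec] using Eq.symm (not_not.1 this)
  · obtain ⟨i, h⟩ := Finset.card_eq_one.1 h
    obtain ⟨a, ha⟩ := sgB_ex (h1 i) ((hm i).1 (by simp [h]))
    refine ⟨.inl (some (i, a)), ?_⟩
    funext k
    simp only [bvec]
    split_ifs with e1
    · rw [e1, ha]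
    · have := (hm k).not.1 (by simp [h, e1])
      simpa using Eq.symm (not_not.1 this)
  · obtain ⟨i, j, hne, h⟩ := Finset.card_eq_two.1 h
    rcases lt_or_gt_of_ne hne with hl | hl
    · exact pair i j hl h
    · exact pair j i hl (by rw [h, Finset.pair_comm])

theorem stmt14 (n : ℕ) (hn : 3 ≤ n) (hmod : n % 15 = 6) :
    ¬ ∃ L : AddSubgroup (Fin n → ℤ), IsLatticeTiling n (errBall n) L := by
  classical
  rintro ⟨L, hL⟩
  let G : Type := (Fin n → ℤ) ⧸ L
  let q : (Fin n → ℤ) →+ G := QuotientAddGroup.mk' L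
  have hq : ∀ x y : Fin n → ℤ, q x = q y ↔ -x + y ∈ L := fun x y => QuotientAddGroup.eq
  let φ : BallIdx n → G := fun x => q (bvec n x)
  have hφ : Function.Bijective φ := by
    constructor
    · intro x y h
      have hxy := (hq _ _).1 h
      apply bvec_inj
      obtain ⟨p, -, hp⟩ := hL (bvec n y)
      have e1 := hp (bvec n y, 0) ⟨bvec_mem n y, L.zero_mem, by simp⟩
      have e2 := hp (bvec n x, -bvec n x + bvec n y) ⟨bvec_mem n x, hxy, by simp⟩
      have := e2.trans e1.symm
      exact congrArg Prod.fst this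
    · intro g
      obtain ⟨v, rfl⟩ := QuotientAddGroup.mk'_surjective L g
      obtain ⟨p, ⟨h1, h2, h3⟩, -⟩ := hL v
      obtain ⟨x, hx⟩ := bvec_surj n p.1 h1
      refine ⟨x, ?_⟩
      refine (hq _ _).2 ?_
      rw [hx, h3]; simpa using h2
  haveI : Fintype G := Fintype.ofBijective φ hφ
  let s : Fin n → G := fun i => q (fun k => if k = i then 1 else 0)
  have hsg : ∀ i a, q (fun k => if k = i then sgB a else 0) = sgB a • s i := by
    intro i a
    rw [← map_zsmul]
    congr 1
    funext k
    simp
  have φ0 : φ (.inl none) = 0 := map_zero q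
  have φ1 : ∀ i a, φ (.inl (some (i, a))) = sgB a • s i := hsg
  have φ2 : ∀ p a b, φ (.inr (p, a, b)) = sgB a • s p.1.1 + sgB b • s p.1.2 := by
    intro p a b
    rw [← hsg, ← hsg, ← map_add]
    change q _ = q _
    congr 1
    funext k
    have := p.2.ne
    simp only [bvec, Pi.add_apply]
    grind
  let ψ : Option (Fin n × Bool) → G := fun x => φ (.inl x)
  have hψ : Function.Injective ψ := fun x y h => Sum.inl_injective (hφ.1 h)
  let A : Finset G := Finset.univ.image ψ
  let z : ℕ → Fin n → AddMonoidAlgebra ℤ G := fun k i =>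
    AddMonoidAlgebra.single (k • s i) 1 + AddMonoidAlgebra.single (-(k • s i)) 1
  have hE : ∀ k, grpE A k = 1 + ∑ i, z k i := by
    intro k
    unfold grpE
    rw [Finset.sum_image (fun x _ y _ h => hψ h), Fintype.sum_option, Fintype.sum_prod_type]
    simp only [ψ, φ0, φ1]
    simp [sgB, z, AddMonoidAlgebra.one_def]
  have hz2 : ∀ i, z 1 i ^ 2 = z 2 i + 2 := by
    intro i
    have e : (AddMonoidAlgebra.single (s i) (1:ℤ)) * AddMonoidAlgebra.single (-s i) 1 = 1 := by
      rw [AddMonoidAlgebra.single_mul_single, AddMonoidAlgebra.one_def]; simp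
    have e1 : (AddMonoidAlgebra.single (s i) (1:ℤ)) ^ 2 = AddMonoidAlgebra.single (2 • s i) 1 := by
      rw [AddMonoidAlgebra.single_pow]; simp
    have e2 : (AddMonoidAlgebra.single (-s i) (1:ℤ)) ^ 2
        = AddMonoidAlgebra.single (-(2 • s i)) 1 := by
      rw [AddMonoidAlgebra.single_pow]; simp
    simp only [z, one_smul]
    linear_combination e1 + e2 + 2 * e
  have hGG : grpAll G = 1 + ∑ i, z 1 i
      + ∑ p : {p : Fin n × Fin n // p.1 < p.2}, z 1 p.1.1 * z 1 p.1.2 := by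
    have : grpAll G = ∑ x, AddMonoidAlgebra.single (φ x) 1 :=
      (Fintype.sum_bijective φ hφ _ _ (fun _ => rfl)).symm
    rw [this, Fintype.sum_sum_type, Fintype.sum_option, Fintype.sum_prod_type,
      Fintype.sum_prod_type]
    simp only [φ0, φ1, φ2, Fintype.sum_prod_type]
    congr 1
    · simp [sgB, z, AddMonoidAlgebra.one_def]
    · refine Finset.sum_congr rfl fun p _ => ?_
      simp only [Fintype.sum_bool, sgB, z, mul_add, add_mul, AddMonoidAlgebra.single_mul_single]
      simp
      abel
  have hsq := sq_sum_pairs n (z 1)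
  have hcard : Fintype.card G = 2 * n ^ 2 + 1 := by
    rw [← Fintype.card_of_bijective hφ]
    have := sq_sum_pairs n (fun _ => (1:ℤ))
    simp only [Finset.sum_const, Finset.card_univ, nsmul_eq_mul, Fintype.card_fin] at this
    simp only [Fintype.card_sum, Fintype.card_option, Fintype.card_prod, Fintype.card_fin,
      Fintype.card_bool]
    zify
    linarith
  refine grp_main n hn hmod A ?_ hcard ?_ ?_ ?_
  · rw [Finset.card_image_of_injective _ hψ]
    simp; ring
  · exact Finset.mem_image.2 ⟨none, Finset.mem_univ _, φ0⟩
  · intro a ha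
    obtain ⟨x, -, rfl⟩ := Finset.mem_image.1 ha
    rcases x with _ | ⟨i, b⟩
    · exact Finset.mem_image.2 ⟨none, Finset.mem_univ _, by simp [ψ, φ0]⟩
    · refine Finset.mem_image.2 ⟨some (i, !b), Finset.mem_univ _, ?_⟩
      simp only [ψ, φ1]
      cases b
      · simp [sgB]
        exact (neg_neg _).symm
      · simp [sgB]
  · rw [hE, hE, hGG]
    simp only [hz2, Finset.sum_add_distrib] at hsq
    simp at hsq
    push_cast
    linear_combination hsq
end
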